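/- Let γ > 0 and R(z) = Π_S(z) - M_γ⁻¹(2Π_S(z) - z), with zero set Z* = {z : R(z) = 0} nonempty. Then R satisfies a local error bound around Z*: there exist τ > 0 and ε > 0 such that for every z with dist(z, Z*) ≤ ε, one has ‖R(z)‖ ≥ τ · dist(z, Z*). -/

import Mathlib

open Matrix
open scoped InnerProductSpace

noncomputable section

/-- The probability simplex `Δᵈ = {x ∈ ℝᵈ : xᵢ ≥ 0, ∑ᵢ xᵢ = 1}` in Euclidean space. -/
def simplex (d : ℕ) : Set (EuclideanSpace ℝ (Fin d)) :=
  {x | (∀ i, 0 ≤ x i) ∧ ∑ i, x i = 1}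

/-- `S = Δⁿ × Δᵐ ⊆ ℝ^{n+m}`, with coordinates indexed by `Fin n ⊕ Fin m`. -/
def gameSet (n m : ℕ) : Set (EuclideanSpace ℝ (Fin n ⊕ Fin m)) :=
  {z | (∀ i, 0 ≤ z i) ∧ (∑ i : Fin n, z (Sum.inl i)) = 1 ∧ (∑ j : Fin m, z (Sum.inr j)) = 1}

/-- The skew block matrix `K = [[0, A], [-Aᵀ, 0]]`. -/
def Kmat {n m : ℕ} (A : Matrix (Fin n) (Fin m) ℝ) :
    Matrix (Fin n ⊕ Fin m) (Fin n ⊕ Fin m) ℝ :=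
  Matrix.fromBlocks 0 A (-Aᵀ) 0

/-- The block matrix `M_γ = [[I, γA], [-γAᵀ, I]] = I + γK`. -/
def Mmat {n m : ℕ} (A : Matrix (Fin n) (Fin m) ℝ) (γ : ℝ) :
    Matrix (Fin n ⊕ Fin m) (Fin n ⊕ Fin m) ℝ :=
  1 + γ • Kmat A

/-- The game operator `F(x, y) = (A y, -Aᵀ x)`. -/
def Fop {n m : ℕ} (A : Matrix (Fin n) (Fin m) ℝ)
    (z : EuclideanSpace ℝ (Fin n ⊕ Fin m)) : EuclideanSpace ℝ (Fin n ⊕ Fin m) :=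
  Matrix.toEuclideanLin (Kmat A) z

/-- The operator (spectral) norm of a matrix, induced by Euclidean norms. -/
def opNorm {n m : ℕ} (A : Matrix (Fin n) (Fin m) ℝ) : ℝ :=
  ‖LinearMap.toContinuousLinearMap (Matrix.toEuclideanLin A)‖

/-- The duality gap `gap(x, y) = max_{y'∈Δᵐ} xᵀAy' - min_{x'∈Δⁿ} x'ᵀAy`. -/
def gap {n m : ℕ} (A : Matrix (Fin n) (Fin m) ℝ)
    (z : EuclideanSpace ℝ (Fin n ⊕ Fin m)) : ℝ :=
  sSup ((fun y' : EuclideanSpace ℝ (Fin m) =>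
      ∑ i : Fin n, ∑ j : Fin m, z (Sum.inl i) * A i j * y' j) '' simplex m)
    - sInf ((fun x' : EuclideanSpace ℝ (Fin n) =>
      ∑ i : Fin n, ∑ j : Fin m, x' i * A i j * z (Sum.inr j)) '' simplex n)

open Filter Topology

section Hoffman

variable {E ι : Type*} [NormedAddCommGroup E] [InnerProductSpace ℝ E] [FiniteDimensional ℝ E]

/-- On the polar of a polyhedral cone, the norm is controlled by the largest violated
constraint of the cone. -/
theorem exists_norm_le_of_mem_polar (a : ι → E →L[ℝ] ℝ) (J : Finset ι) :
    ∃ C > (0 : ℝ), ∀ v : E, (∀ h, (∀ j ∈ J, a j h ≤ 0) → inner ℝ v h ≤ 0) →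
      ∀ r, 0 ≤ r → (∀ j ∈ J, a j v ≤ r) → ‖v‖ ≤ C * r := by
  set N : Set E := {v | ∀ h, (∀ j ∈ J, a j h ≤ 0) → inner ℝ v h ≤ 0}
  have hN : IsClosed N := by
    simp only [N, Set.ofPred_forall]
    exact isClosed_iInter fun h => isClosed_iInter fun _ =>
      isClosed_le (by fun_prop) continuous_const
  have hX : IsCompact (Metric.sphere (0 : E) 1 ∩ N) := (isCompact_sphere 0 1).inter_right hN
  have hpos : ∀ v ∈ Metric.sphere (0 : E) 1 ∩ N, 0 < ∑ j ∈ J, max (a j v) 0 := by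
    rintro v ⟨hv1, hv⟩
    by_contra! hle
    have h0 : ∀ j ∈ J, a j v ≤ 0 := fun j hj =>
      (le_max_left _ _).trans <|
        (Finset.single_le_sum (f := fun j => max (a j v) 0) (fun _ _ => le_max_right _ _) hj).trans
          hle
    have := hv v h0
    rw [real_inner_self_eq_norm_sq, mem_sphere_zero_iff_norm.1 hv1] at this
    norm_num at this
  obtain ⟨δ, hδ, hmin⟩ := hX.exists_forall_le' (f := fun v => ∑ j ∈ J, max (a j v) 0)
    (by fun_prop) hpos
  refine ⟨(J.card + 1) / δ, by positivity, fun v hv r hr hvr => ?_⟩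
  rcases eq_or_ne v 0 with rfl | hv0
  · simp only [norm_zero]; positivity
  have hnv : 0 < ‖v‖ := norm_pos_iff.2 hv0
  have hu : ‖v‖⁻¹ • v ∈ Metric.sphere (0 : E) 1 ∩ N := by
    refine ⟨by simp [norm_smul, hnv.ne'], fun h hh => ?_⟩
    rw [real_inner_smul_left]
    exact mul_nonpos_of_nonneg_of_nonpos (by positivity) (hv h hh)
  have h1 : δ ≤ J.card * (‖v‖⁻¹ * r) := by
    refine (hmin _ hu).trans ((Finset.sum_le_card_nsmul _ _ _ fun j hj => ?_).trans_eq
      (nsmul_eq_mul _ _))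
    rw [map_smul, smul_eq_mul]
    exact max_le (mul_le_mul_of_nonneg_left (hvr j hj) (by positivity)) (by positivity)
  have h2 : δ * ‖v‖ ≤ J.card * r := by
    calc δ * ‖v‖ ≤ J.card * (‖v‖⁻¹ * r) * ‖v‖ := by gcongr
      _ = J.card * r := by field_simp
  rw [div_mul_eq_mul_div, le_div_iff₀ hδ]
  linarith

/-- **Hoffman's lemma**: the distance to a nonempty polyhedron is bounded by a multiple of the
largest constraint violation. -/
theorem hoffman_error_bound [Fintype ι] (a : ι → E →L[ℝ] ℝ) (b : ι → ℝ) (hne : ∃ p, ∀ i, a i p ≤ b i) :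
    ∃ C > (0 : ℝ), ∀ z r, 0 ≤ r → (∀ i, a i z ≤ b i + r) →
      ∃ p, (∀ i, a i p ≤ b i) ∧ ‖z - p‖ ≤ C * r := by
  choose C hC hCb using exists_norm_le_of_mem_polar a
  refine ⟨∑ J, C J, Finset.sum_pos (fun J _ => hC J) Finset.univ_nonempty, fun z r hr hz => ?_⟩
  set Q : Set E := {p | ∀ i, a i p ≤ b i}
  have hQc : IsClosed Q := by
    simp only [Q, Set.ofPred_forall]
    exact isClosed_iInter fun i => isClosed_le (by fun_prop) continuous_const
  have hQ : Convex ℝ Q := by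
    simp only [Q, Set.ofPred_forall]
    exact convex_iInter fun i => convex_halfSpace_le (a i).toLinearMap.isLinear (b i)
  obtain ⟨p, hp, hpz⟩ := exists_norm_eq_iInf_of_complete_convex (K := Q) hne hQc.isComplete hQ z
  rw [norm_eq_iInf_iff_real_inner_le_zero hQ hp] at hpz
  refine ⟨p, hp, ?_⟩
  classical
  set J : Finset ι := {i | a i p = b i}
  refine (hCb J (z - p) (fun h hh => ?_) r hr fun j hj => ?_).trans ?_
  · have hev : ∀ᶠ t : ℝ in 𝓝[>] 0, ∀ i, a i (p + t • h) ≤ b i := by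
      rw [eventually_all]
      intro i
      rcases (hp i).eq_or_lt with hi | hi
      · filter_upwards [self_mem_nhdsWithin] with t ht
        have := hh i (by simp [J, hi])
        simp only [map_add, map_smul, smul_eq_mul]
        nlinarith [Set.mem_Ioi.1 ht]
      · have hc : ContinuousAt (fun t : ℝ => a i (p + t • h)) 0 := by fun_prop
        have := hc.eventually_lt continuousAt_const (by simpa using hi : _ < b i)
        exact (this.filter_mono nhdsWithin_le_nhds).mono fun t ht => ht.le
    obtain ⟨t, ht, ht0⟩ := (hev.and self_mem_nhdsWithin).exists
    have := hpz _ ht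
    rw [add_sub_cancel_left, real_inner_smul_right] at this
    exact nonpos_of_mul_nonpos_right this ht0
  · have hj' : a j p = b j := by simpa [J] using hj
    rw [map_sub, hj']
    linarith [hz j]
  · gcongr
    exact Finset.single_le_sum (fun J _ => (hC J).le) (Finset.mem_univ J)

/-- A version of Hoffman's lemma on a compact set that also covers an empty polyhedron. -/
theorem hoffman_error_bound_of_isCompact [Fintype ι] (a : ι → E →L[ℝ] ℝ) (b : ι → ℝ)
    {X : Set E} (hX : IsCompact X) :
    ∃ C > (0 : ℝ), ∀ z ∈ X, ∀ r, 0 ≤ r → (∀ i, a i z ≤ b i + r) →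
      1 ≤ C * r ∨ ∃ p, (∀ i, a i p ≤ b i) ∧ ‖z - p‖ ≤ C * r := by
  by_cases hne : ∃ p, ∀ i, a i p ≤ b i
  · obtain ⟨C, hC, h⟩ := hoffman_error_bound a b hne
    exact ⟨C, hC, fun z _ r hr hz => Or.inr (h z r hr hz)⟩
  push Not at hne
  have hpos : ∀ z ∈ X, 0 < ∑ i, max (a i z - b i) 0 := fun z _ => by
    obtain ⟨i, hi⟩ := hne z
    exact Finset.sum_pos' (fun _ _ => le_max_right _ _)
      ⟨i, Finset.mem_univ i, lt_max_of_lt_left (sub_pos.2 hi)⟩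
  obtain ⟨δ, hδ, hmin⟩ := hX.exists_forall_le' (f := fun z => ∑ i, max (a i z - b i) 0)
    (by fun_prop) hpos
  refine ⟨(Fintype.card ι + 1) / δ, by positivity, fun z hz r hr hzr => Or.inl ?_⟩
  have h1 : δ ≤ Fintype.card ι * r :=
    (hmin z hz).trans ((Finset.sum_le_card_nsmul _ _ r fun i _ =>
      max_le (by linarith [hzr i]) hr).trans_eq (nsmul_eq_mul _ _))
  rw [div_mul_eq_mul_div, le_div_iff₀ hδ]
  linarith

end Hoffman

section Simplex

theorem sum_mul_sub_nonpos {α : Type*} [Fintype α] {v w p : α → ℝ} (hw : ∀ i, 0 ≤ w i)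
    (hp : ∀ i, 0 ≤ p i) (hw1 : ∑ i, w i = 1) (hp1 : ∑ i, p i = 1)
    (hv : ∀ i j, p j ≠ 0 → v i ≤ v j) : ∑ i, v i * (w i - p i) ≤ 0 := by
  have key : ∑ i, v i * (w i - p i) = ∑ i, ∑ j, (v i - v j) * (w i * p j) := by
    have e1 : ∑ i, ∑ j, v i * (w i * p j) = ∑ i, v i * w i := by
      simp [← Finset.mul_sum, hp1]
    have e2 : ∑ i, ∑ j, v j * (w i * p j) = ∑ j, v j * p j := by
      rw [Finset.sum_comm]
      simp_rw [mul_left_comm _ (w _), ← Finset.sum_mul, hw1, one_mul]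
    simp only [sub_mul, Finset.sum_sub_distrib, mul_sub, e1, e2]
  rw [key]
  refine Finset.sum_nonpos fun i _ => Finset.sum_nonpos fun j _ => ?_
  by_cases hj : p j = 0
  · simp [hj]
  · exact mul_nonpos_of_nonpos_of_nonneg (sub_nonpos.2 (hv i j hj)) (mul_nonneg (hw i) (hp j))

variable {n m : ℕ}

theorem convex_gameSet : Convex ℝ (gameSet n m) := by
  rintro x ⟨hx, hx1, hx2⟩ y ⟨hy, hy1, hy2⟩ s t hs ht hst
  refine ⟨fun i => ?_, ?_, ?_⟩
  · have := hx i
    have := hy i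
    simp only [PiLp.add_apply, PiLp.smul_apply, smul_eq_mul]
    positivity
  · simp [Finset.sum_add_distrib, ← Finset.mul_sum, hx1, hy1, hst]
  · simp [Finset.sum_add_distrib, ← Finset.mul_sum, hx2, hy2, hst]

theorem isCompact_gameSet : IsCompact (gameSet n m) := by
  refine (isCompact_closedBall (0 : EuclideanSpace ℝ (Fin n ⊕ Fin m)) 2).of_isClosed_subset
    ?_ fun z hz => ?_
  · simp only [gameSet, Set.ofPred_and, Set.ofPred_forall]
    exact (isClosed_iInter fun i => isClosed_le continuous_const (by fun_prop)).inter
      ((isClosed_eq (by fun_prop) continuous_const).inter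
        (isClosed_eq (by fun_prop) continuous_const))
  · obtain ⟨h0, h1, h2⟩ := hz
    rw [mem_closedBall_zero_iff]
    have hsum : ∑ i, z i = 2 := by rw [Fintype.sum_sum_type, h1, h2]; norm_num
    have hle : ∀ i, z i ≤ 2 := fun i =>
      hsum ▸ Finset.single_le_sum (fun j _ => h0 j) (Finset.mem_univ i)
    refine abs_le_of_sq_le_sq' ?_ (by norm_num) |>.2
    rw [EuclideanSpace.real_norm_sq_eq]
    calc ∑ i, z i ^ 2 ≤ ∑ i, 2 * z i :=
          Finset.sum_le_sum fun i _ => by nlinarith [h0 i, hle i]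
      _ = 2 ^ 2 := by rw [← Finset.mul_sum, hsum]; norm_num

/-- Variational characterization of the projection onto the game set. -/
theorem inner_sub_le_zero_of_isProj {z p : EuclideanSpace ℝ (Fin n ⊕ Fin m)}
    (hp : p ∈ gameSet n m) (hmin : ∀ w ∈ gameSet n m, ‖z - p‖ ≤ ‖z - w‖) :
    ∀ w ∈ gameSet n m, inner ℝ (z - p) (w - p) ≤ 0 := by
  have : Nonempty (gameSet n m) := ⟨⟨p, hp⟩⟩
  refine (norm_eq_iInf_iff_real_inner_le_zero convex_gameSet hp).1 (le_antisymm ?_ ?_)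
  · exact le_ciInf fun w => hmin w w.2
  · exact ciInf_le (f := fun w : gameSet n m => ‖z - w‖)
      ⟨0, Set.forall_mem_range.2 fun _ => norm_nonneg _⟩ ⟨p, hp⟩

theorem eq_of_inner_sub_le_zero {z p q : EuclideanSpace ℝ (Fin n ⊕ Fin m)}
    (h₁ : inner ℝ (z - p) (q - p) ≤ 0) (h₂ : inner ℝ (z - q) (p - q) ≤ 0) : q = p := by
  have e : inner ℝ (z - p) (q - p) + inner ℝ (z - q) (p - q) = ‖q - p‖ ^ 2 := by
    rw [← neg_sub q p, inner_neg_right, ← sub_eq_add_neg, ← inner_sub_left,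
      sub_sub_sub_cancel_left, real_inner_self_eq_norm_sq]
  have : ‖q - p‖ ^ 2 ≤ 0 := by linarith
  exact sub_eq_zero.1 (norm_eq_zero.1 (by nlinarith [norm_nonneg (q - p)]))

/-- A normal vector to the game set at `p` is maximal, within each block, on the support of `p`. -/
theorem apply_le_apply_of_inner_sub_le_zero {v p : EuclideanSpace ℝ (Fin n ⊕ Fin m)}
    (hp : p ∈ gameSet n m) (hv : ∀ w ∈ gameSet n m, inner ℝ v (w - p) ≤ 0)
    {i j : Fin n ⊕ Fin m} (hij : i.isLeft = j.isLeft) (hj : p j ≠ 0) : v i ≤ v j := by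
  obtain ⟨h0, h1, h2⟩ := hp
  have hj0 : 0 < p j := (h0 j).lt_of_ne' hj
  have hw : p + p j • (EuclideanSpace.single i 1 - EuclideanSpace.single j 1) ∈ gameSet n m := by
    refine ⟨fun k => ?_, ?_, ?_⟩
    · have hk := h0 k
      by_cases hkj : k = j <;> by_cases hki : k = i <;>
        simp_all <;> positivity
    · rcases i with i | i <;> rcases j with j | j <;>
        simp_all [PiLp.single_apply, Finset.sum_add_distrib, ← Finset.mul_sum]
    · rcases i with i | i <;> rcases j with j | j <;>
        simp_all [PiLp.single_apply, Finset.sum_add_distrib, ← Finset.mul_sum]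
  have := hv _ hw
  rw [add_sub_cancel_left, real_inner_smul_right, inner_sub_right,
    EuclideanSpace.inner_single_right, EuclideanSpace.inner_single_right] at this
  simpa using nonpos_of_mul_nonpos_right this hj0

theorem inner_sub_le_zero_of_apply_le_apply {v w p : EuclideanSpace ℝ (Fin n ⊕ Fin m)}
    (hw : w ∈ gameSet n m) (hp : p ∈ gameSet n m)
    (hv : ∀ i j : Fin n ⊕ Fin m, i.isLeft = j.isLeft → p j ≠ 0 → v i ≤ v j) :
    inner ℝ v (w - p) ≤ 0 := by
  have e : inner ℝ v (w - p) = ∑ i, v i * (w i - p i) := by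
    simp [PiLp.inner_apply, mul_comm]
  rw [e, Fintype.sum_sum_type]
  exact add_nonpos
    (sum_mul_sub_nonpos (fun i => hw.1 _) (fun i => hp.1 _) hw.2.1 hp.2.1
      fun i j => hv (Sum.inl i) (Sum.inl j) rfl)
    (sum_mul_sub_nonpos (fun i => hw.1 _) (fun i => hp.1 _) hw.2.2 hp.2.2
      fun i j => hv (Sum.inr i) (Sum.inr j) rfl)

/-- Error bound for the polyhedron of points of the game set that are supported in `J` and at which
`D` is maximal, within each block, on `J`. -/
theorem exists_error_bound_of_support
    (D : EuclideanSpace ℝ (Fin n ⊕ Fin m) →L[ℝ] EuclideanSpace ℝ (Fin n ⊕ Fin m))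
    (J : Finset (Fin n ⊕ Fin m)) :
    ∃ C > (0 : ℝ), ∀ p ∈ gameSet n m, (∀ i ∉ J, p i = 0) → ∀ r, 0 ≤ r →
      (∀ i, ∀ j ∈ J, i.isLeft = j.isLeft → D p i ≤ D p j + r) →
      1 ≤ C * r ∨ ∃ q ∈ gameSet n m, (∀ i ∉ J, q i = 0) ∧
        (∀ i, ∀ j ∈ J, i.isLeft = j.isLeft → D q i ≤ D q j) ∧ ‖p - q‖ ≤ C * r := by
  let e (i : Fin n ⊕ Fin m) : EuclideanSpace ℝ (Fin n ⊕ Fin m) →L[ℝ] ℝ := EuclideanSpace.proj i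
  let s : Fin 2 → EuclideanSpace ℝ (Fin n ⊕ Fin m) →L[ℝ] ℝ :=
    ![∑ i : Fin n, e (Sum.inl i), ∑ j : Fin m, e (Sum.inr j)]
  let T := {q : (Fin n ⊕ Fin m) × (Fin n ⊕ Fin m) // q.2 ∈ J ∧ q.1.isLeft = q.2.isLeft}
  let a : (Fin n ⊕ Fin m) ⊕ {i // i ∉ J} ⊕ T ⊕ Fin 2 ⊕ Fin 2 →
      EuclideanSpace ℝ (Fin n ⊕ Fin m) →L[ℝ] ℝ :=
    Sum.elim (fun i => -e i) (Sum.elim (fun i => e i)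
      (Sum.elim (fun q => (e q.1.1 - e q.1.2) ∘L D) (Sum.elim s (-s))))
  let b : (Fin n ⊕ Fin m) ⊕ {i // i ∉ J} ⊕ T ⊕ Fin 2 ⊕ Fin 2 → ℝ :=
    Sum.elim 0 (Sum.elim 0 (Sum.elim 0 (Sum.elim 1 (-1))))
  obtain ⟨C, hC, h⟩ := hoffman_error_bound_of_isCompact a b (isCompact_gameSet (n := n) (m := m))
  refine ⟨C, hC, fun p hp hpJ r hr hD => (h p hp r hr ?_).imp_right ?_⟩
  · obtain ⟨h0, h1, h2⟩ := hp
    rintro (i | i | q | k | k)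
    · simpa [a, b, e] using by linarith [h0 i]
    · simpa [a, b, e, hpJ i i.2] using hr
    · simpa [a, b, e, add_comm] using hD q.1.1 q.1.2 q.2.1 q.2.2
    · fin_cases k <;> simp [a, b, e, s, h1, h2, hr]
    · fin_cases k <;> simp [a, b, e, s, h1, h2, hr]
  · rintro ⟨q, hq, hpq⟩
    have hq0 : ∀ i, 0 ≤ q i := fun i => by simpa [a, b, e] using hq (Sum.inl i)
    have hs := fun k => hq (Sum.inr (Sum.inr (Sum.inr (Sum.inl k))))
    have hs' := fun k => hq (Sum.inr (Sum.inr (Sum.inr (Sum.inr k))))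
    refine ⟨q, ⟨hq0, le_antisymm ?_ ?_, le_antisymm ?_ ?_⟩, fun i hi => ?_,
      fun i j hj hij => ?_, hpq⟩
    · simpa [a, b, e, s] using hs 0
    · simpa [a, b, e, s] using hs' 0
    · simpa [a, b, e, s] using hs 1
    · simpa [a, b, e, s] using hs' 1
    · exact le_antisymm (by simpa [a, b, e] using hq (Sum.inr (Sum.inl ⟨i, hi⟩))) (hq0 i)
    · simpa [a, b, e] using hq (Sum.inr (Sum.inr (Sum.inl ⟨(i, j), hj, hij⟩)))

theorem isUnit_det_Mmat (A : Matrix (Fin n) (Fin m) ℝ) (γ : ℝ) : IsUnit (Mmat A γ).det := by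
  rw [isUnit_iff_ne_zero]
  intro hdet
  obtain ⟨v, hv, hMv⟩ := Matrix.exists_mulVec_eq_zero_iff.2 hdet
  have hK : (Kmat A)ᵀ = -Kmat A := by
    simp [Kmat, Matrix.fromBlocks_transpose, Matrix.fromBlocks_neg]
  have hskew : v ⬝ᵥ (Kmat A *ᵥ v) = 0 := by
    have : v ⬝ᵥ (Kmat A *ᵥ v) = -(v ⬝ᵥ (Kmat A *ᵥ v)) := by
      conv_lhs => rw [Matrix.dotProduct_mulVec, ← Matrix.mulVec_transpose, hK, Matrix.neg_mulVec,
        neg_dotProduct, dotProduct_comm]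
    linarith
  have : v ⬝ᵥ (Mmat A γ *ᵥ v) = v ⬝ᵥ v := by
    simp [Mmat, Matrix.add_mulVec, Matrix.smul_mulVec, dotProduct_add, hskew]
  rw [hMv, dotProduct_zero] at this
  exact hv (dotProduct_self_eq_zero.1 this.symm)

end Simplex

theorem residual_local_error_bound {n m : ℕ} (A : Matrix (Fin n) (Fin m) ℝ)
    (γ : ℝ) (hγ : 0 < γ)
    (proj : EuclideanSpace ℝ (Fin n ⊕ Fin m) → EuclideanSpace ℝ (Fin n ⊕ Fin m))
    (hproj : ∀ z, proj z ∈ gameSet n m ∧ ∀ w ∈ gameSet n m, ‖z - proj z‖ ≤ ‖z - w‖)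
    (R : EuclideanSpace ℝ (Fin n ⊕ Fin m) → EuclideanSpace ℝ (Fin n ⊕ Fin m))
    (hR : ∀ z, R z = proj z - Matrix.toEuclideanLin (Mmat A γ)⁻¹ ((2 : ℝ) • proj z - z))
    (Zstar : Set (EuclideanSpace ℝ (Fin n ⊕ Fin m))) (hZstar : Zstar = {z | R z = 0})
    (hne : Zstar.Nonempty) :
    ∃ τ > (0 : ℝ), ∃ ε > (0 : ℝ),
      ∀ z : EuclideanSpace ℝ (Fin n ⊕ Fin m), Metric.infDist z Zstar ≤ ε →
        τ * Metric.infDist z Zstar ≤ ‖R z‖ := by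
  set M : EuclideanSpace ℝ (Fin n ⊕ Fin m) →L[ℝ] EuclideanSpace ℝ (Fin n ⊕ Fin m) :=
    LinearMap.toContinuousLinearMap (Matrix.toEuclideanLin (Mmat A γ))
  have hM : ∀ x, M (Matrix.toEuclideanLin (Mmat A γ)⁻¹ x) = x := fun x => by
    simp [M, Matrix.toLpLin_apply, Matrix.mul_nonsing_inv _ (isUnit_det_Mmat A γ)]
  have hM' : ∀ x, Matrix.toEuclideanLin (Mmat A γ)⁻¹ (M x) = x := fun x => by
    simp [M, Matrix.toLpLin_apply, Matrix.nonsing_inv_mul _ (isUnit_det_Mmat A γ)]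
  choose C hC hCb using exists_error_bound_of_support
    (ContinuousLinearMap.id ℝ (EuclideanSpace ℝ (Fin n ⊕ Fin m)) - M)
  set c := ∑ J, C J
  have hc : 0 ≤ c := Finset.sum_nonneg fun J _ => (hC J).le
  set L := 2 * (c * (2 * ‖M‖)) + ‖M‖ * (c * (2 * ‖M‖)) + ‖M‖ + c * (2 * ‖M‖) + 1
  have hL : 0 < L := by positivity
  refine ⟨L⁻¹, by positivity, 1, one_pos, fun z hz => ?_⟩
  rw [inv_mul_le_iff₀ hL]
  set p := proj z
  have hp : p ∈ gameSet n m := (hproj z).1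
  have hnormal := inner_sub_le_zero_of_isProj hp (hproj z).2
  have hz_eq : z = (2 : ℝ) • p - M (p - R z) := by
    rw [hR z, sub_sub_cancel, hM, sub_sub_cancel]
  have hv : z - p = (p - M p) + M (R z) := by
    nth_rewrite 1 [hz_eq]
    rw [map_sub, two_smul]
    abel
  have hMr : ‖M (R z)‖ ≤ ‖M‖ * ‖R z‖ := M.le_opNorm _
  have hcoord : ∀ i, |M (R z) i| ≤ ‖M‖ * ‖R z‖ := fun i =>
    (PiLp.norm_apply_le (M (R z)) i).trans hMr
  classical
  set J : Finset (Fin n ⊕ Fin m) := {i | p i ≠ 0}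
  have hCc : C J ≤ c := Finset.single_le_sum (fun J _ => (hC J).le) (Finset.mem_univ J)
  have hbound : C J * (2 * (‖M‖ * ‖R z‖)) ≤ c * (2 * ‖M‖) * ‖R z‖ := by
    calc C J * (2 * (‖M‖ * ‖R z‖)) ≤ c * (2 * (‖M‖ * ‖R z‖)) := by gcongr
      _ = c * (2 * ‖M‖) * ‖R z‖ := by ring
  have hD : ∀ i, ∀ j ∈ J, i.isLeft = j.isLeft →
      (ContinuousLinearMap.id ℝ (EuclideanSpace ℝ (Fin n ⊕ Fin m)) - M) p i ≤
        (ContinuousLinearMap.id ℝ (EuclideanSpace ℝ (Fin n ⊕ Fin m)) - M) p j +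
          2 * (‖M‖ * ‖R z‖) := by
    intro i j hj hij
    have := apply_le_apply_of_inner_sub_le_zero hp hnormal hij (by simpa [J] using hj)
    rw [hv] at this
    simp only [PiLp.add_apply] at this
    simp only [_root_.sub_apply, ContinuousLinearMap.id_apply]
    linarith [abs_le.1 (hcoord i), abs_le.1 (hcoord j)]
  rcases hCb J p hp (fun i hi => by simpa [J] using hi) (2 * (‖M‖ * ‖R z‖)) (by positivity)
    hD with h1 | ⟨q, hq, hqJ, hqD, hpq⟩
  · calc Metric.infDist z Zstar ≤ c * (2 * ‖M‖) * ‖R z‖ := hz.trans (h1.trans hbound)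
      _ ≤ L * ‖R z‖ := by
        gcongr
        simp only [L]
        nlinarith [show 0 ≤ 2 * (c * (2 * ‖M‖)) + ‖M‖ * (c * (2 * ‖M‖)) + ‖M‖ by positivity]
  · have hqproj : proj ((2 : ℝ) • q - M q) = q := by
      obtain ⟨hmem, hmin⟩ := hproj ((2 : ℝ) • q - M q)
      refine eq_of_inner_sub_le_zero ?_ (inner_sub_le_zero_of_isProj hmem hmin q hq)
      refine inner_sub_le_zero_of_apply_le_apply hmem hq fun i j hij hj => ?_
      have e : (2 : ℝ) • q - M q - q =
          (ContinuousLinearMap.id ℝ (EuclideanSpace ℝ (Fin n ⊕ Fin m)) - M) q := by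
        rw [two_smul, _root_.sub_apply, ContinuousLinearMap.id_apply]
        abel
      rw [e]
      exact hqD i j (by by_contra hjJ; exact hj (hqJ j hjJ)) hij
    have hqZ : (2 : ℝ) • q - M q ∈ Zstar := by
      rw [hZstar, Set.mem_ofPred_eq, hR, hqproj, sub_sub_cancel, hM', sub_self]
    have hdiff : z - ((2 : ℝ) • q - M q) = (2 : ℝ) • (p - q) - M (p - q) + M (R z) := by
      nth_rewrite 1 [hz_eq]
      simp only [map_sub, smul_sub]
      abel
    have hpq' : ‖p - q‖ ≤ c * (2 * ‖M‖) * ‖R z‖ := hpq.trans hbound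
    calc Metric.infDist z Zstar ≤ ‖z - ((2 : ℝ) • q - M q)‖ := by
          rw [← dist_eq_norm]; exact Metric.infDist_le_dist_of_mem hqZ
      _ ≤ 2 * ‖p - q‖ + ‖M‖ * ‖p - q‖ + ‖M‖ * ‖R z‖ := by
          rw [hdiff]
          refine (norm_add_le _ _).trans (add_le_add ((norm_sub_le _ _).trans ?_) hMr)
          rw [norm_smul, Real.norm_two]
          gcongr
          exact M.le_opNorm _
      _ ≤ 2 * (c * (2 * ‖M‖) * ‖R z‖) + ‖M‖ * (c * (2 * ‖M‖) * ‖R z‖) + ‖M‖ * ‖R z‖ := by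
          gcongr
      _ ≤ L * ‖R z‖ := by
          simp only [L]
          nlinarith [show 0 ≤ (c * (2 * ‖M‖) + 1) * ‖R z‖ by positivity]

end
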